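/- Let k be a field, let A and B be associative unital k-algebras, and let τ : B ⊗ₖ A → A ⊗ₖ B be a twisting map. For each n ≥ 0 define the iterated twist τ_n : B ⊗ A^{⊗(n+2)} → A^{⊗(n+2)} ⊗ B by τ_n = (1_{A^{⊗(n+1)}} ⊗ τ) ∘ (1_{A^{⊗n}} ⊗ τ ⊗ 1_A) ∘ ⋯ ∘ (τ ⊗ 1_{A^{⊗(n+1)}}), i.e., by successively applying τ to move the B-factor past each A-factor from left to right. Then τ_• is a chain map with respect to the bar differentials: for every n ≥ 1, (d_n ⊗ 1_B) ∘ τ_n = τ_{n−1} ∘ (1_B ⊗ d_n), where d_n : A^{⊗(n+2)} → A^{⊗(n+1)} is given by d_n(a_0 ⊗ ⋯ ⊗ a_{n+1}) = Σ_{i=0}^{n} (−1)^i a_0 ⊗ ⋯ ⊗ a_i a_{i+1} ⊗ ⋯ ⊗ a_{n+1}. -/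

import Mathlib

open TensorProduct LinearMap

noncomputable section

universe u
variable (k A B : Type u) [Field k] [Ring A] [Algebra k A] [Ring B] [Algebra k B]

/-- The right-hand side of the twisting-map condition on `(B ⊗ B) ⊗ (A ⊗ A)`. -/
def twistRHS (τ : B ⊗[k] A →ₗ[k] A ⊗[k] B) :
    ((B ⊗[k] B) ⊗[k] (A ⊗[k] A)) →ₗ[k] (A ⊗[k] B) :=
  map (mul' k A) (mul' k B)
    ∘ₗ (TensorProduct.assoc k A A (B ⊗[k] B)).symm.toLinearMap
    ∘ₗ lTensor A (TensorProduct.assoc k A B B).toLinearMap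
    ∘ₗ lTensor A (rTensor B τ)
    ∘ₗ lTensor A (TensorProduct.assoc k B A B).symm.toLinearMap
    ∘ₗ (TensorProduct.assoc k A B (A ⊗[k] B)).toLinearMap
    ∘ₗ map τ τ
    ∘ₗ (TensorProduct.assoc k B A (B ⊗[k] A)).symm.toLinearMap
    ∘ₗ lTensor B (TensorProduct.assoc k A B A).toLinearMap
    ∘ₗ lTensor B (rTensor A τ)
    ∘ₗ lTensor B (TensorProduct.assoc k B A A).symm.toLinearMap
    ∘ₗ (TensorProduct.assoc k B B (A ⊗[k] A)).toLinearMap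

/-- `τ : B ⊗ A → A ⊗ B` is a twisting map. -/
def IsTwistingMap (τ : B ⊗[k] A →ₗ[k] A ⊗[k] B) : Prop :=
  (∀ a : A, τ ((1 : B) ⊗ₜ[k] a) = a ⊗ₜ[k] (1 : B)) ∧
  (∀ b : B, τ (b ⊗ₜ[k] (1 : A)) = (1 : A) ⊗ₜ[k] b) ∧
  τ ∘ₗ map (mul' k B) (mul' k A) = twistRHS k A B τ

/-- `TP k A n` is the `(n+1)`-fold tensor power `A ⊗ ⋯ ⊗ A`, right-nested. -/
def TP : ℕ → ModuleCat.{u} k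
  | 0 => ModuleCat.of k A
  | n + 1 => ModuleCat.of k (A ⊗[k] TP n)

/-- Multiplication of the first two tensor factors of `A^{⊗(n+2)}`. -/
def firstMul (n : ℕ) : (A ⊗[k] (A ⊗[k] TP k A n)) →ₗ[k] (A ⊗[k] TP k A n) :=
  rTensor (TP k A n) (mul' k A) ∘ₗ (TensorProduct.assoc k A A (TP k A n)).symm.toLinearMap

/-- The bar differential `d_n : A^{⊗(n+2)} → A^{⊗(n+1)}`,
`d_n(a_0 ⊗ ⋯ ⊗ a_{n+1}) = Σ_{i=0}^n (-1)^i a_0 ⊗ ⋯ ⊗ a_i a_{i+1} ⊗ ⋯ ⊗ a_{n+1}`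
(for `n = 0` this is the multiplication map `A ⊗ A → A`). -/
def barD : (n : ℕ) → (TP k A (n+1) : Type u) →ₗ[k] (TP k A n : Type u)
  | 0 => mul' k A
  | n + 1 =>
    firstMul k A n -
      lTensor A (show (A ⊗[k] TP k A n : Type u) →ₗ[k] (TP k A n : Type u) from barD n)

/-- The iterated twist `B ⊗ A^{⊗(n+1)} → A^{⊗(n+1)} ⊗ B`, obtained by successively
applying `τ` to move the `B`-factor past each `A`-factor from left to right. -/
def tauIter (τ : B ⊗[k] A →ₗ[k] A ⊗[k] B) :
    (n : ℕ) → (B ⊗[k] TP k A n) →ₗ[k] ((TP k A n : Type u) ⊗[k] B)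
  | 0 => τ
  | n + 1 =>
    show (B ⊗[k] (A ⊗[k] TP k A n)) →ₗ[k] ((A ⊗[k] TP k A n) ⊗[k] B) from
      (TensorProduct.assoc k A (TP k A n) B).symm.toLinearMap
        ∘ₗ lTensor A (tauIter τ n)
        ∘ₗ (TensorProduct.assoc k A B (TP k A n)).toLinearMap
        ∘ₗ rTensor (TP k A n) τ
        ∘ₗ (TensorProduct.assoc k B A (TP k A n)).symm.toLinearMap

/-- Move `B` past `M ⊗ N`, first past `M` along `f`, then past `N` along `g`. -/
def twistTensor {k B M N : Type*} [CommRing k] [AddCommGroup B] [Module k B]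
    [AddCommGroup M] [Module k M] [AddCommGroup N] [Module k N]
    (f : B ⊗[k] M →ₗ[k] M ⊗[k] B) (g : B ⊗[k] N →ₗ[k] N ⊗[k] B) :
    B ⊗[k] (M ⊗[k] N) →ₗ[k] (M ⊗[k] N) ⊗[k] B :=
  (TensorProduct.assoc k M N B).symm.toLinearMap
    ∘ₗ lTensor M g
    ∘ₗ (TensorProduct.assoc k M B N).toLinearMap
    ∘ₗ rTensor N f
    ∘ₗ (TensorProduct.assoc k B M N).symm.toLinearMap

section TwistTensor

variable {k B M M' N N' P : Type*} [CommRing k] [AddCommGroup B] [Module k B]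
  [AddCommGroup M] [Module k M] [AddCommGroup N] [Module k N]
  [AddCommGroup M'] [Module k M'] [AddCommGroup N'] [Module k N']
  [AddCommGroup P] [Module k P]

theorem twistTensor_lTensor (f : B ⊗[k] M →ₗ[k] M ⊗[k] B)
    {g : B ⊗[k] N →ₗ[k] N ⊗[k] B} {g' : B ⊗[k] N' →ₗ[k] N' ⊗[k] B} {h : N →ₗ[k] N'}
    (hg : rTensor B h ∘ₗ g = g' ∘ₗ lTensor B h) :
    rTensor B (lTensor M h) ∘ₗ twistTensor f g =
      twistTensor f g' ∘ₗ lTensor B (lTensor M h) := by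
  apply TensorProduct.ext_threefold'
  intro b m n
  simp only [twistTensor, LinearMap.comp_apply, LinearEquiv.coe_coe, assoc_symm_tmul,
    rTensor_tmul, lTensor_tmul]
  induction f (b ⊗ₜ[k] m) with
  | zero => simp
  | add x y hx hy => simp only [add_tmul, map_add, hx, hy]
  | tmul m b =>
    have hb := LinearMap.congr_fun hg (b ⊗ₜ n)
    simp only [LinearMap.comp_apply, lTensor_tmul] at hb
    simp only [assoc_tmul, lTensor_tmul, ← hb]
    induction g (b ⊗ₜ[k] n) with
    | zero => simp
    | add x y hx hy => simp only [tmul_add, map_add, hx, hy]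
    | tmul n b => simp

theorem twistTensor_rTensor (g : B ⊗[k] N →ₗ[k] N ⊗[k] B)
    {f : B ⊗[k] M →ₗ[k] M ⊗[k] B} {f' : B ⊗[k] M' →ₗ[k] M' ⊗[k] B} {h : M →ₗ[k] M'}
    (hf : rTensor B h ∘ₗ f = f' ∘ₗ lTensor B h) :
    rTensor B (rTensor N h) ∘ₗ twistTensor f g =
      twistTensor f' g ∘ₗ lTensor B (rTensor N h) := by
  apply TensorProduct.ext_threefold'
  intro b m n
  have hb := LinearMap.congr_fun hf (b ⊗ₜ m)
  simp only [LinearMap.comp_apply, lTensor_tmul] at hb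
  simp only [twistTensor, LinearMap.comp_apply, LinearEquiv.coe_coe, assoc_symm_tmul,
    rTensor_tmul, lTensor_tmul, ← hb]
  induction f (b ⊗ₜ[k] m) with
  | zero => simp
  | add x y hx hy => simp only [add_tmul, map_add, hx, hy]
  | tmul m b =>
    simp only [assoc_tmul, lTensor_tmul, rTensor_tmul]
    induction g (b ⊗ₜ[k] n) with
    | zero => simp
    | add x y hx hy => simp only [tmul_add, map_add, hx, hy]
    | tmul n b => simp

theorem twistTensor_assoc (f : B ⊗[k] M →ₗ[k] M ⊗[k] B) (g : B ⊗[k] N →ₗ[k] N ⊗[k] B)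
    (h : B ⊗[k] P →ₗ[k] P ⊗[k] B) :
    rTensor B (TensorProduct.assoc k M N P).symm.toLinearMap ∘ₗ
        twistTensor f (twistTensor g h) =
      twistTensor (twistTensor f g) h ∘ₗ
        lTensor B (TensorProduct.assoc k M N P).symm.toLinearMap := by
  ext b m n p
  simp only [twistTensor, AlgebraTensorModule.curry_apply, curry_apply,
    LinearMap.coe_restrictScalars, LinearMap.comp_apply, LinearEquiv.coe_coe, assoc_symm_tmul,
    rTensor_tmul, lTensor_tmul]
  induction f (b ⊗ₜ[k] m) with
  | zero => simp
  | add x y hx hy => simp only [add_tmul, map_add, hx, hy]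
  | tmul m b =>
    simp only [assoc_tmul, assoc_symm_tmul, LinearMap.comp_apply, LinearEquiv.coe_coe,
      lTensor_tmul, rTensor_tmul]
    induction g (b ⊗ₜ[k] n) with
    | zero => simp
    | add x y hx hy => simp only [add_tmul, tmul_add, map_add, hx, hy]
    | tmul n b =>
      simp only [assoc_tmul, assoc_symm_tmul, lTensor_tmul]
      induction h (b ⊗ₜ[k] p) with
      | zero => simp
      | add x y hx hy => simp only [tmul_add, map_add, hx, hy]
      | tmul p b => simp

theorem rTensor_sub_comp {h h' : M →ₗ[k] N} {f : B ⊗[k] M →ₗ[k] M ⊗[k] B}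
    {g : B ⊗[k] N →ₗ[k] N ⊗[k] B} (hh : rTensor B h ∘ₗ f = g ∘ₗ lTensor B h)
    (hh' : rTensor B h' ∘ₗ f = g ∘ₗ lTensor B h') :
    rTensor B (h - h') ∘ₗ f = g ∘ₗ lTensor B (h - h') := by
  rw [rTensor_sub, lTensor_sub, LinearMap.sub_comp, LinearMap.comp_sub, hh, hh']

end TwistTensor

variable {k A B} in
/-- The twisting condition with one `B`-factor equal to `1`: `τ` is compatible with `m_A`. -/
theorem IsTwistingMap.mul'_comp_twistTensor {τ : B ⊗[k] A →ₗ[k] A ⊗[k] B}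
    (hτ : IsTwistingMap k A B τ) :
    rTensor B (mul' k A) ∘ₗ twistTensor τ τ = τ ∘ₗ lTensor B (mul' k A) := by
  obtain ⟨h1, -, h3⟩ := hτ
  apply TensorProduct.ext_threefold'
  intro b a a'
  have h := LinearMap.congr_fun h3 (((1 : B) ⊗ₜ[k] b) ⊗ₜ[k] (a ⊗ₜ[k] a'))
  simp only [twistRHS, LinearMap.comp_apply, LinearEquiv.coe_coe, map_tmul, mul'_apply, one_mul,
    assoc_tmul, assoc_symm_tmul, lTensor_tmul, rTensor_tmul] at h
  simp only [twistTensor, LinearMap.comp_apply, LinearEquiv.coe_coe, assoc_symm_tmul,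
    rTensor_tmul, lTensor_tmul, mul'_apply]
  rw [h]
  induction τ (b ⊗ₜ[k] a) with
  | zero => simp
  | add x y hx hy => simp only [add_tmul, tmul_add, map_add, hx, hy]
  | tmul a b =>
    simp only [assoc_tmul, assoc_symm_tmul, lTensor_tmul, map_tmul, h1]
    induction τ (b ⊗ₜ[k] a') with
    | zero => simp
    | add x y hx hy => simp only [tmul_add, map_add, hx, hy]
    | tmul a b => simp [h1]

theorem firstMul_comp_twistTensor {τ : B ⊗[k] A →ₗ[k] A ⊗[k] B}
    (hτ : IsTwistingMap k A B τ) (n : ℕ) (g : B ⊗[k] TP k A n →ₗ[k] TP k A n ⊗[k] B) :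
    rTensor B (firstMul k A n) ∘ₗ twistTensor τ (twistTensor τ g) =
      twistTensor τ g ∘ₗ lTensor B (firstMul k A n) := by
  rw [firstMul, rTensor_comp, lTensor_comp, LinearMap.comp_assoc, twistTensor_assoc,
    ← LinearMap.comp_assoc, twistTensor_rTensor g hτ.mul'_comp_twistTensor,
    LinearMap.comp_assoc]

theorem rTensor_barD_comp_tauIter {τ : B ⊗[k] A →ₗ[k] A ⊗[k] B}
    (hτ : IsTwistingMap k A B τ) (n : ℕ) :
    rTensor B (barD k A n) ∘ₗ tauIter k A B τ (n + 1) =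
      tauIter k A B τ n ∘ₗ lTensor B (barD k A n) := by
  induction n with
  | zero => exact hτ.mul'_comp_twistTensor
  | succ n ih =>
    exact rTensor_sub_comp (firstMul_comp_twistTensor k A B hτ n (tauIter k A B τ n))
      (twistTensor_lTensor τ ih)

/-- For a twisting map `τ`, the iterated twists
`τ_n : B ⊗ A^{⊗(n+2)} → A^{⊗(n+2)} ⊗ B` form a chain map with respect to the
bar differentials: `(d_n ⊗ 1_B) ∘ τ_n = τ_{n-1} ∘ (1_B ⊗ d_n)` for all `n ≥ 1`.
(Here `τ_n = tauIter τ (n+1)` and `d_n = barD n`.) -/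
theorem tauIter_chainMap (τ : B ⊗[k] A →ₗ[k] A ⊗[k] B)
    (hτ : IsTwistingMap k A B τ) :
    ∀ n : ℕ, 1 ≤ n →
      rTensor B (barD k A n) ∘ₗ tauIter k A B τ (n + 1) =
        tauIter k A B τ n ∘ₗ lTensor B (barD k A n) := by
  exact fun n _ => rTensor_barD_comp_tauIter k A B hτ n

end
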